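/- arXiv:math/0510394 — 2 statements merged into one kernel-verified Lean document; each statement's English description precedes it below -/
import Mathlib

section
/- Let A_0 be the unique positive real solution of A − (1/2)e^{−2A} = 3/2 (so A_0 = 1.5238...), and let φ : ℕ → ℝ be any function with φ(n) → ∞ as n → ∞. If t = t(n) is a sequence of integers with t(n) = A_0·n − φ(n)·√n (up to rounding), and t(n) pebbles are placed independently and uniformly at random on the n vertices of the complete graph K_n, then the probability that the resulting configuration is cover solvable tends to 0 as n → ∞. -/
/-- A single pebbling move on a graph `G`: two pebbles are removed from a vertex `u`
and one pebble is placed on an adjacent vertex `v`. -/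
def PebblingMove {V : Type*} [DecidableEq V] (G : SimpleGraph V) (C C' : V → ℕ) : Prop :=
  ∃ u v : V, G.Adj u v ∧ 2 ≤ C u ∧
    C' = Function.update (Function.update C u (C u - 2)) v (C v + 1)

/-- A configuration is cover solvable if some finite sequence of pebbling moves
results in a configuration with at least one pebble on every vertex. -/
def CoverSolvable {V : Type*} [DecidableEq V] (G : SimpleGraph V) (C : V → ℕ) : Prop :=
  ∃ C' : V → ℕ, Relation.ReflTransGen (PebblingMove G) C C' ∧ ∀ v, 1 ≤ C' v

/-- The configuration on `n` vertices induced by an assignment `f` of `t`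
distinguishable pebbles to vertices: vertex `v` gets `#{p | f p = v}` pebbles. -/
def mbConfig {n t : ℕ} (f : Fin t → Fin n) : Fin n → ℕ :=
  fun v => (Finset.univ.filter fun p : Fin t => f p = v).card

/-- The probability, when `t` distinguishable pebbles are placed independently and
uniformly at random on the `n` vertices of the complete graph `K_n` (Maxwell
Boltzmann scheme, all `n^t` assignments equally likely), that the resulting
configuration is cover solvable. -/
noncomputable def mbCoverProb (n t : ℕ) : ℝ :=
  (Nat.card {f : Fin t → Fin n //
      CoverSolvable (⊤ : SimpleGraph (Fin n)) (mbConfig f)} : ℝ) / (n : ℝ) ^ t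

open Finset in
/-- On any graph, `∑ v, ⌊(C v + 1) / 2⌋` does not increase under a pebbling move. -/
lemma PebblingMove.sum_half_le {V : Type*} [Fintype V] [DecidableEq V] {G : SimpleGraph V}
    {C C' : V → ℕ} (h : PebblingMove G C C') :
    ∑ v, (C' v + 1) / 2 ≤ ∑ v, (C v + 1) / 2 := by
  obtain ⟨u, v, huv, hu, rfl⟩ := h
  have hne : u ≠ v := huv.ne
  have hv : v ∈ univ.erase u := by simp [hne.symm]
  rw [← add_sum_erase _ _ (mem_univ u), ← add_sum_erase _ _ (mem_univ u),
    ← add_sum_erase _ _ hv, ← add_sum_erase _ _ hv]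
  have hrest : ∑ x ∈ (univ.erase u).erase v,
      (Function.update (Function.update C u (C u - 2)) v (C v + 1) x + 1) / 2 =
      ∑ x ∈ (univ.erase u).erase v, (C x + 1) / 2 := by
    refine sum_congr rfl fun x hx => ?_
    simp only [mem_erase] at hx
    rw [Function.update_of_ne hx.1, Function.update_of_ne hx.2.1]
  rw [hrest, Function.update_of_ne hne, Function.update_self, Function.update_self]
  omega

lemma CoverSolvable.card_le_sum_half {V : Type*} [Fintype V] [DecidableEq V] {G : SimpleGraph V}
    {C : V → ℕ} (h : CoverSolvable G C) : Fintype.card V ≤ ∑ v, (C v + 1) / 2 := by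
  obtain ⟨C', hC, hpos⟩ := h
  have hmono : ∑ v, (C' v + 1) / 2 ≤ ∑ v, (C v + 1) / 2 := by
    clear hpos
    induction hC with
    | refl => exact le_rfl
    | tail _ hstep ih => exact hstep.sum_half_le.trans ih
  refine le_trans ?_ hmono
  calc Fintype.card V = ∑ _v : V, 1 := by simp
    _ ≤ _ := Finset.sum_le_sum fun v _ => by have := hpos v; omega

lemma neg_one_pow_eq_two_mul_add_one_sub (c : ℕ) :
    (-1 : ℝ) ^ c = 2 * c + 1 - 4 * ((c + 1) / 2 : ℕ) := by
  obtain ⟨k, rfl | rfl⟩ := Nat.even_or_odd' c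
  · rw [pow_mul, show (2 * k + 1) / 2 = k by omega]
    push_cast
    norm_num
    ring
  · rw [pow_succ, pow_mul, show (2 * k + 1 + 1) / 2 = k + 1 by omega]
    push_cast
    norm_num
    ring

/-- The number of vertices carrying an even number of pebbles minus the number of vertices
carrying an odd number. -/
noncomputable def paritySum {n t : ℕ} (f : Fin t → Fin n) : ℝ :=
  ∑ v, (-1 : ℝ) ^ mbConfig f v

lemma sum_mbConfig {n t : ℕ} (f : Fin t → Fin n) : ∑ v, mbConfig f v = t := by
  simpa [mbConfig] using
    (Finset.card_eq_sum_card_fiberwise (f := f) (s := Finset.univ) (t := Finset.univ)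
      (fun _ _ => Finset.mem_coe.2 (Finset.mem_univ _))).symm

lemma CoverSolvable.paritySum_le {n t : ℕ} {f : Fin t → Fin n} {G : SimpleGraph (Fin n)}
    (h : CoverSolvable G (mbConfig f)) : paritySum f ≤ 2 * t - 3 * n := by
  have hle : (n : ℝ) ≤ ∑ v, ((mbConfig f v + 1) / 2 : ℕ) := by
    have := h.card_le_sum_half
    rw [Fintype.card_fin] at this
    exact_mod_cast this
  have hsum : ∑ v, (mbConfig f v : ℝ) = t := by exact_mod_cast sum_mbConfig f
  have : paritySum f = 2 * t + n - 4 * ∑ v, (((mbConfig f v + 1) / 2 : ℕ) : ℝ) := by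
    simp only [paritySum, neg_one_pow_eq_two_mul_add_one_sub, Finset.sum_sub_distrib,
      Finset.sum_add_distrib, ← Finset.mul_sum, hsum]
    simp
  push_cast at hle
  linarith

/-- The sign contributed by a pebble on `w` to the parity of the pebbles on `v`. -/
noncomputable def pebbleSign {n : ℕ} (v w : Fin n) : ℝ := if w = v then -1 else 1

lemma neg_one_pow_mbConfig {n t : ℕ} (f : Fin t → Fin n) (v : Fin n) :
    (-1 : ℝ) ^ mbConfig f v = ∏ p, pebbleSign v (f p) := by
  simp [pebbleSign, mbConfig, Finset.prod_ite]

lemma sum_pebbleSign {n : ℕ} (v : Fin n) : ∑ w, pebbleSign v w = n - 2 := by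
  have (w : Fin n) : pebbleSign v w = 1 - if w = v then 2 else 0 := by
    unfold pebbleSign; split_ifs <;> norm_num
  simp [this]

lemma sum_pebbleSign_mul_self {n : ℕ} (v : Fin n) :
    ∑ w, pebbleSign v w * pebbleSign v w = n := by
  have (w : Fin n) : pebbleSign v w * pebbleSign v w = 1 := by
    unfold pebbleSign; split_ifs <;> norm_num
  simp [this]

lemma sum_pebbleSign_mul {n : ℕ} {u v : Fin n} (h : u ≠ v) :
    ∑ w, pebbleSign u w * pebbleSign v w = n - 4 := by
  have (w : Fin n) : pebbleSign u w * pebbleSign v w =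
      1 - (if w = u then 2 else 0) - if w = v then 2 else 0 := by
    unfold pebbleSign; split_ifs <;> simp_all <;> norm_num
  simp [this]
  ring

lemma sum_paritySum (n t : ℕ) : ∑ f : Fin t → Fin n, paritySum f = n * ((n : ℝ) - 2) ^ t := by
  simp only [paritySum, neg_one_pow_mbConfig]
  rw [Finset.sum_comm]
  simp [← Fintype.sum_pow, sum_pebbleSign]

lemma sum_paritySum_sq (n t : ℕ) :
    ∑ f : Fin t → Fin n, paritySum f ^ 2 =
      n * (n : ℝ) ^ t + n * (n - 1) * ((n : ℝ) - 4) ^ t := by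
  have hsq (f : Fin t → Fin n) : paritySum f ^ 2 =
      ∑ u, ∑ v, ∏ p, (pebbleSign u (f p) * pebbleSign v (f p)) := by
    simp only [paritySum, neg_one_pow_mbConfig, sq, Finset.sum_mul_sum, Finset.prod_mul_distrib]
  have hpair (u v : Fin n) :
      ∑ f : Fin t → Fin n, ∏ p, (pebbleSign u (f p) * pebbleSign v (f p)) =
        ((n : ℝ) - 4) ^ t + if u = v then (n : ℝ) ^ t - ((n : ℝ) - 4) ^ t else 0 := by
    rw [← Fintype.sum_pow (fun w => pebbleSign u w * pebbleSign v w) t]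
    split_ifs with h
    · subst h; rw [sum_pebbleSign_mul_self]; ring
    · rw [sum_pebbleSign_mul h]; ring
  simp only [hsq]
  rw [Finset.sum_comm]
  simp_rw [Finset.sum_comm (s := (Finset.univ : Finset (Fin t → Fin n))), hpair,
    Finset.sum_add_distrib]
  simp
  ring

/-- The parity sum has variance at most `n`. -/
lemma sum_paritySum_sub_sq_le {n : ℕ} (hn : 4 ≤ n) (t : ℕ) :
    ∑ f : Fin t → Fin n, (paritySum f - n * (1 - 2 / (n : ℝ)) ^ t) ^ 2 ≤ n * (n : ℝ) ^ t := by
  have hn' : (4 : ℝ) ≤ n := by exact_mod_cast hn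
  have hn0 : (0 : ℝ) < n := by linarith
  set q : ℝ := (1 - 2 / (n : ℝ)) ^ t with hq
  have hq2 : ((n : ℝ) - 2) ^ t = n ^ t * q := by
    rw [hq, ← mul_pow]; congr 1; field_simp
  have hq4 : ((n : ℝ) - 4) ^ t ≤ n ^ t * q ^ 2 := by
    rw [hq, ← pow_mul, mul_comm t 2, pow_mul, ← mul_pow]
    refine pow_le_pow_left₀ (by linarith) ?_ t
    have : (n : ℝ) * (1 - 2 / n) ^ 2 = n - 4 + 4 / n := by field_simp; ring
    rw [this]
    have : (0 : ℝ) < 4 / n := by positivity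
    linarith
  have hexp : ∑ f : Fin t → Fin n, (paritySum f - n * q) ^ 2 =
      n * (n : ℝ) ^ t + n * (n - 1) * ((n : ℝ) - 4) ^ t - n * n * (n ^ t * q ^ 2) := by
    simp only [sub_sq, Finset.sum_add_distrib, Finset.sum_sub_distrib, sum_paritySum_sq,
      ← Finset.mul_sum, ← Finset.sum_mul, sum_paritySum, hq2]
    simp
    ring
  rw [hexp]
  have h0 : (0 : ℝ) ≤ n ^ t * q ^ 2 := by positivity
  have h1 : (n : ℝ) * (n - 1) * ((n : ℝ) - 4) ^ t ≤ n * (n - 1) * (n ^ t * q ^ 2) :=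
    mul_le_mul_of_nonneg_left hq4 (mul_nonneg hn0.le (by linarith))
  nlinarith [mul_nonneg hn0.le h0]

lemma mbCoverProb_nonneg (n t : ℕ) : 0 ≤ mbCoverProb n t := by
  unfold mbCoverProb; positivity

/-- Chebyshev's inequality for the parity sum. -/
lemma mbCoverProb_le {n : ℕ} (hn : 4 ≤ n) (t : ℕ) {δ : ℝ} (hδ : 0 < δ)
    (h : δ ≤ n * (1 - 2 / (n : ℝ)) ^ t - (2 * t - 3 * n)) :
    mbCoverProb n t ≤ n / δ ^ 2 := by
  classical
  have hn0 : (0 : ℝ) < n := by exact_mod_cast (by omega : 0 < n)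
  have hcard : (Nat.card {f : Fin t → Fin n //
      CoverSolvable (⊤ : SimpleGraph (Fin n)) (mbConfig f)} : ℝ) * δ ^ 2 ≤ n * (n : ℝ) ^ t := by
    refine le_trans ?_ (sum_paritySum_sub_sq_le hn t)
    rw [Nat.card_eq_fintype_card, Fintype.card_subtype, ← nsmul_eq_mul]
    refine (Finset.card_nsmul_le_sum _
      (fun f : Fin t → Fin n => (paritySum f - n * (1 - 2 / (n : ℝ)) ^ t) ^ 2) _ ?_).trans
      (Finset.sum_le_sum_of_subset_of_nonneg (Finset.subset_univ _) fun _ _ _ => sq_nonneg _)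
    intro f hf
    have := (Finset.mem_filter.1 hf).2.paritySum_le
    rw [← neg_sq (paritySum f - _)]
    exact pow_le_pow_left₀ hδ.le (by linarith) 2
  unfold mbCoverProb
  rwa [div_le_div_iff₀ (by positivity) (by positivity)]

lemma exp_neg_sub_le_one_sub_pow {A : ℝ} (hA : 0 ≤ A) {n t : ℕ} (hn : 4 ≤ n)
    (ht : (t : ℝ) ≤ A * n) :
    Real.exp (-2 * A) - 8 * A / n ≤ (1 - 2 / (n : ℝ)) ^ t := by
  have hn' : (4 : ℝ) ≤ n := by exact_mod_cast hn
  have hn0 : (0 : ℝ) < n := by linarith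
  have hn2 : (0 : ℝ) < n - 2 := by linarith
  have hbase : 0 < 1 - 2 / (n : ℝ) := by
    rw [sub_pos, div_lt_one hn0]; linarith
  have hlog : -(2 / ((n : ℝ) - 2)) ≤ Real.log (1 - 2 / (n : ℝ)) := by
    refine le_trans (le_of_eq ?_) (Real.one_sub_inv_le_log_of_pos hbase)
    have : 1 - 2 / (n : ℝ) = (n - 2) / n := by field_simp
    rw [this, inv_div]
    field_simp
    ring
  have hexpo : -2 * A + -(8 * A / n) ≤ t * Real.log (1 - 2 / (n : ℝ)) := by
    refine le_trans ?_ (mul_le_mul_of_nonneg_left hlog (Nat.cast_nonneg t))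
    have h1 : (t : ℝ) * (2 / (n - 2)) ≤ A * n * (2 / (n - 2)) := by gcongr
    have h2 : A * n * (2 / ((n : ℝ) - 2)) ≤ 2 * A + 8 * A / n := by
      have : 2 * A + 8 * A / n - A * n * (2 / ((n : ℝ) - 2)) =
          4 * A * (n - 4) / (n * (n - 2)) := by
        field_simp
        ring
      have : 0 ≤ 4 * A * ((n : ℝ) - 4) / (n * (n - 2)) :=
        div_nonneg (mul_nonneg (by positivity) (by linarith)) (by positivity)
      linarith
    linarith
  calc Real.exp (-2 * A) - 8 * A / n
      ≤ Real.exp (-2 * A) * (1 - 8 * A / n) := by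
        have h1 : Real.exp (-2 * A) ≤ 1 := Real.exp_le_one_iff.2 (by linarith)
        have h2 : 0 ≤ 8 * A / n := by positivity
        nlinarith
    _ ≤ Real.exp (-2 * A) * Real.exp (-(8 * A / n)) := by
        gcongr
        exact Real.one_sub_le_exp_neg _
    _ ≤ Real.exp (t * Real.log (1 - 2 / (n : ℝ))) := by
        rw [← Real.exp_add]
        exact Real.exp_le_exp.2 hexpo
    _ = (1 - 2 / (n : ℝ)) ^ t := by
        rw [Real.exp_nat_mul, Real.exp_log hbase]

/-- Let `A₀` be the unique positive solution of `A − (1/2)e^{−2A} = 3/2` and let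
`φ(n) → ∞`.  If `t(n) = A₀·n − φ(n)·√n` (up to rounding), then the probability
that `t(n)` pebbles placed uniformly at random on `K_n` (Maxwell Boltzmann
scheme) form a cover solvable configuration tends to `0`. -/
theorem mb_cover_threshold_lower (A0 : ℝ) (hA0pos : 0 < A0)
    (hA0 : A0 - (1 / 2) * Real.exp (-2 * A0) = 3 / 2)
    (φ : ℕ → ℝ) (hφ : Filter.Tendsto φ Filter.atTop Filter.atTop)
    (t : ℕ → ℕ) (ht : ∀ n, |(t n : ℝ) - (A0 * n - φ n * Real.sqrt n)| ≤ 1) :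
    Filter.Tendsto (fun n => mbCoverProb n (t n)) Filter.atTop (nhds 0) := by
  have hbound : ∀ᶠ n in Filter.atTop, mbCoverProb n (t n) ≤ (φ n ^ 2)⁻¹ := by
    filter_upwards [hφ.eventually_ge_atTop (2 + 8 * A0), Filter.eventually_ge_atTop 4]
      with n hφn hn
    have hn' : (4 : ℝ) ≤ n := by exact_mod_cast hn
    have hn0 : (0 : ℝ) < n := by linarith
    have hsqrt : 1 ≤ Real.sqrt n := Real.one_le_sqrt.2 (by linarith)
    have hφ0 : 0 < φ n := by linarith
    have hprod : φ n ≤ φ n * Real.sqrt n := le_mul_of_one_le_right hφ0.le hsqrt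
    have htn := (abs_le.1 (ht n)).2
    have hpow := exp_neg_sub_le_one_sub_pow hA0pos.le hn (t := t n) (by linarith)
    have hmean : n * Real.exp (-2 * A0) - 8 * A0 ≤ n * (1 - 2 / (n : ℝ)) ^ t n := by
      refine le_trans (le_of_eq ?_) (mul_le_mul_of_nonneg_left hpow hn0.le)
      field_simp
    have hexp : Real.exp (-2 * A0) = 2 * A0 - 3 := by linarith
    rw [hexp] at hmean
    refine (mbCoverProb_le hn (t n) (δ := φ n * Real.sqrt n) (by positivity) ?_).trans ?_
    · linarith
    · rw [mul_pow, Real.sq_sqrt hn0.le]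
      apply le_of_eq
      field_simp
  refine squeeze_zero' (Filter.Eventually.of_forall fun n => mbCoverProb_nonneg n (t n)) hbound ?_
  exact ((Filter.tendsto_pow_atTop two_ne_zero).comp hφ).inv_tendsto_atTop
end

section
/- Suppose a configuration of weight t on the n vertices of K_n is chosen uniformly at random from all C(n+t−1, n−1) configurations (Bose Einstein scheme), and let X be the number of vertices with an odd number of pebbles. Then for every λ > 0, P(|X − E(X)| ≥ λ) ≤ 2·exp(−λ²/(8t)). -/
/-- The configurations of weight `t` on `n` vertices: functions `C : Fin n → ℕ`
with `∑ v, C v = t`.  There are `C(n+t−1, n−1)` of them. -/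
def configs (n t : ℕ) : Finset (Fin n → ℕ) := Finset.Nat.antidiagonalTuple n t

/-- The number of vertices carrying an odd number of pebbles ("odd stacks"). -/
def oddStacks {n : ℕ} (C : Fin n → ℕ) : ℕ :=
  (Finset.univ.filter fun v => Odd (C v)).card

/-- The expected number of odd stacks when a configuration of weight `t` on `n`
vertices is chosen uniformly at random among all `C(n+t−1, n−1)` configurations
(Bose Einstein scheme). -/
noncomputable def beExpOddStacks (n t : ℕ) : ℝ :=
  (∑ C ∈ configs n t, (oddStacks C : ℝ)) / ((n + t - 1).choose (n - 1) : ℝ)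

open Finset in
/-- Adding a pebble to a size-biased vertex: the Pólya urn recursion for configurations. -/
lemma sum_configs_succ {n : ℕ} (t : ℕ) (f : (Fin n → ℕ) → ℝ) :
    ∑ C ∈ configs n t, ∑ v, ((C v : ℝ) + 1) * f (C + Pi.single v 1)
      = (t + 1) * ∑ C ∈ configs n (t + 1), f C := by
  have fiber (v : Fin n) : ∑ C ∈ configs n t, ((C v : ℝ) + 1) * f (C + Pi.single v 1)
      = ∑ C ∈ configs n (t + 1), (C v : ℝ) * f C := by
    rw [← sum_filter_of_ne (s := configs n (t + 1)) (p := fun C => C v ≠ 0)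
      (by intro C _ h h0; simp [h0] at h)]
    have single_le {C : Fin n → ℕ} (h : C v ≠ 0) : Pi.single v 1 ≤ C := by
      intro w
      rcases eq_or_ne w v with rfl | hw
      · simpa using Nat.one_le_iff_ne_zero.mpr h
      · simp [hw]
    refine sum_bij' (fun C _ => C + Pi.single v 1) (fun C _ => C - Pi.single v 1) ?_ ?_ ?_ ?_ ?_
    · intro C hC
      simp only [configs, Nat.mem_antidiagonalTuple, mem_filter] at hC ⊢
      simp [sum_add_distrib, hC]
    · intro C hC
      simp only [configs, Nat.mem_antidiagonalTuple, mem_filter] at hC ⊢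
      have := congrArg (fun D : Fin n → ℕ => ∑ w, D w) (tsub_add_cancel_of_le (single_le hC.2))
      simp only [Pi.add_apply, sum_add_distrib, sum_pi_single', mem_univ, if_true] at this
      omega
    · intro C _
      exact add_tsub_cancel_right _ _
    · intro C hC
      exact tsub_add_cancel_of_le (single_le (mem_filter.mp hC).2)
    · intro C _
      simp
  rw [sum_comm, sum_congr rfl fun v _ => fiber v, sum_comm, mul_sum]
  refine sum_congr rfl fun C hC => ?_
  rw [← sum_mul, ← Nat.cast_sum, Nat.mem_antidiagonalTuple.mp hC]
  push_cast
  rfl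

lemma card_configs (m t : ℕ) : (configs (m + 1) t).card = (m + t).choose m := by
  induction t with
  | zero => simp [configs, Finset.Nat.antidiagonalTuple_zero_right]
  | succ t ih =>
    have h := sum_configs_succ (n := m + 1) t fun _ => 1
    have inner : ∀ C ∈ configs (m + 1) t, ∑ v, ((C v : ℝ) + 1) * 1 = t + (m + 1) := by
      intro C hC
      simp [Finset.sum_add_distrib, ← Nat.cast_sum, Finset.Nat.mem_antidiagonalTuple.mp hC]
    rw [Finset.sum_congr rfl inner] at h
    simp only [Finset.sum_const, nsmul_eq_mul, mul_one, ih] at h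
    have h' : (m + t).choose m * (t + (m + 1)) = (t + 1) * (configs (m + 1) (t + 1)).card := by
      exact_mod_cast h
    have hc := Nat.choose_mul_succ_eq (m + t) m
    rw [show m + t + 1 - m = t + 1 by omega] at hc
    refine Nat.eq_of_mul_eq_mul_left (Nat.succ_pos t) ?_
    rw [← add_assoc, Nat.succ_eq_add_one, ← h', mul_comm (t + 1), ← hc]
    ring

/-- A weak form of Hoeffding's lemma for finite weighted averages. -/
lemma sum_mul_exp_le_of_abs_le_one {ι : Type*} [Fintype ι] (p d : ι → ℝ) (hp : ∀ i, 0 ≤ p i)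
    (hp1 : ∑ i, p i = 1) (hd : ∀ i, |d i| ≤ 1) (θ : ℝ) :
    ∑ i, p i * Real.exp (θ * d i) ≤ Real.exp (θ * ∑ i, p i * d i + 2 * θ ^ 2) := by
  set μ := ∑ i, p i * d i with hμ_def
  have hμ : |μ| ≤ 1 := by
    refine (Finset.abs_sum_le_sum_abs _ _).trans (hp1 ▸ Finset.sum_le_sum fun i _ => ?_)
    rw [abs_mul, abs_of_nonneg (hp i)]
    exact mul_le_of_le_one_right (hp i) (hd i)
  have pointwise (i : ι) : p i * Real.exp (θ * d i) ≤ Real.exp (θ * μ) *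
      (p i * Real.cosh (2 * θ) + (p i * d i - p i * μ) * (Real.sinh (2 * θ) / 2)) := by
    have hy : |(d i - μ) / 2| ≤ 1 := by
      have h1 := abs_le.mp (hd i)
      have h2 := abs_le.mp hμ
      exact abs_le.mpr ⟨by linarith, by linarith⟩
    have h := Real.exp_mul_le_cosh_add_mul_sinh hy (2 * θ)
    rw [show θ * d i = θ * μ + (d i - μ) / 2 * (2 * θ) by ring, Real.exp_add]
    calc _ = Real.exp (θ * μ) * p i * Real.exp ((d i - μ) / 2 * (2 * θ)) := by ring
      _ ≤ Real.exp (θ * μ) * p i * (Real.cosh (2 * θ) + (d i - μ) / 2 * Real.sinh (2 * θ)) :=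
        mul_le_mul_of_nonneg_left h (mul_nonneg (Real.exp_pos _).le (hp i))
      _ = _ := by ring
  refine (Finset.sum_le_sum fun i _ => pointwise i).trans ?_
  rw [← Finset.mul_sum, Finset.sum_add_distrib, ← Finset.sum_mul, ← Finset.sum_mul,
    Finset.sum_sub_distrib, ← Finset.sum_mul, hp1, ← hμ_def, Real.exp_add]
  have hcosh := Real.cosh_le_exp_half_sq (2 * θ)
  rw [show (2 * θ) ^ 2 / 2 = 2 * θ ^ 2 by ring] at hcosh
  refine mul_le_mul_of_nonneg_left ?_ (Real.exp_pos _).le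
  linarith

lemma sum_comp_add_single {n : ℕ} (g : ℕ → ℝ) (C : Fin n → ℕ) (v : Fin n) :
    ∑ w, g ((C + Pi.single v 1 : Fin n → ℕ) w) = ∑ w, g (C w) + (g (C v + 1) - g (C v)) := by
  rw [← sub_eq_iff_eq_add', ← Finset.sum_sub_distrib, Finset.sum_eq_single v]
  · simp
  · intro w _ hw
    simp [hw]
  · simp

/-- The moment generating function of an additive statistic with summands in `[0, 1]` of a
uniformly random configuration is sub-Gaussian with variance proxy `4 * t`. -/
lemma sum_configs_exp_le (m t : ℕ) (θ : ℝ) (g : ℕ → ℝ) (hg : ∀ k ≤ t, g k ∈ Set.Icc (0 : ℝ) 1) :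
    ∑ C ∈ configs (m + 1) t, Real.exp (θ * ∑ v, g (C v)) ≤ (configs (m + 1) t).card *
      Real.exp (θ * ((∑ C ∈ configs (m + 1) t, ∑ v, g (C v)) / (configs (m + 1) t).card)
        + 2 * θ ^ 2 * t) := by
  induction t generalizing g with
  | zero => simp [configs, Finset.Nat.antidiagonalTuple_zero_right]
  | succ t ih =>
    have hN : (0 : ℝ) < t + (m + 1) := by positivity
    set p : ℕ → ℝ := fun k => (k + 1) / (t + (m + 1)) with hp
    set g' : ℕ → ℝ := fun k => g k + p k * (g (k + 1) - g k) with hg'_def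
    have hg' : ∀ k ≤ t, g' k ∈ Set.Icc (0 : ℝ) 1 := by
      intro k hk
      have hp0 : 0 ≤ p k := by positivity
      have hp1 : p k ≤ 1 := by
        have : (k : ℝ) ≤ t := by exact_mod_cast hk
        exact (div_le_one hN).mpr (by linarith [(Nat.cast_nonneg m : (0 : ℝ) ≤ m)])
      have h1 := hg k (by omega)
      have h2 := hg (k + 1) (by omega)
      have h := (convex_Icc (0 : ℝ) 1) h1 h2 (sub_nonneg.mpr hp1) hp0 (by ring)
      convert h using 1
      simp only [smul_eq_mul, hg'_def]
      ring
    have sum_p {C : Fin (m + 1) → ℕ} (hC : C ∈ configs (m + 1) t) : ∑ v, p (C v) = 1 := by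
      simp only [hp, ← Finset.sum_div]
      rw [div_eq_one_iff_eq hN.ne']
      simp [Finset.sum_add_distrib, ← Nat.cast_sum, Finset.Nat.mem_antidiagonalTuple.mp hC]
    have recur (f : (Fin (m + 1) → ℕ) → ℝ) :
        (∑ C ∈ configs (m + 1) (t + 1), f C) * ((t + 1) / (t + (m + 1)))
          = ∑ C ∈ configs (m + 1) t, ∑ v, p (C v) * f (C + Pi.single v 1) := by
      have h := sum_configs_succ t f
      rw [mul_div_assoc', mul_comm _ ((t : ℝ) + 1), ← h, Finset.sum_div]
      refine Finset.sum_congr rfl fun C _ => ?_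
      rw [Finset.sum_div]
      exact Finset.sum_congr rfl fun v _ => by simp only [hp]; ring
    have hc : (0 : ℝ) < (t + 1) / (t + (m + 1)) := by positivity
    have card_eq : ((configs (m + 1) (t + 1)).card : ℝ) * ((t + 1) / (t + (m + 1)))
        = (configs (m + 1) t).card := by
      have h := recur fun _ => 1
      simp only [mul_one] at h
      rw [Finset.sum_congr rfl fun C hC => sum_p hC] at h
      simpa using h
    have mean_step {C : Fin (m + 1) → ℕ} (hC : C ∈ configs (m + 1) t) :
        ∑ v, p (C v) * ∑ w, g ((C + Pi.single v 1 : Fin (m + 1) → ℕ) w) = ∑ v, g' (C v) := by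
      simp only [sum_comp_add_single, mul_add, Finset.sum_add_distrib, ← Finset.sum_mul,
        sum_p hC, hg'_def, one_mul]
    have mean_eq : (∑ C ∈ configs (m + 1) (t + 1), ∑ v, g (C v)) / (configs (m + 1) (t + 1)).card
        = (∑ C ∈ configs (m + 1) t, ∑ v, g' (C v)) / (configs (m + 1) t).card := by
      rw [← card_eq, ← Finset.sum_congr rfl fun C hC => mean_step hC,
        ← recur fun C => ∑ w, g (C w), mul_div_mul_right _ _ hc.ne']
    have exp_step {C : Fin (m + 1) → ℕ} (hC : C ∈ configs (m + 1) t) :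
        ∑ v, p (C v) * Real.exp (θ * ∑ w, g ((C + Pi.single v 1 : Fin (m + 1) → ℕ) w))
          ≤ Real.exp (θ * ∑ v, g' (C v)) * Real.exp (2 * θ ^ 2) := by
      have hle (v) : C v ≤ t := by
        rw [← Finset.Nat.mem_antidiagonalTuple.mp hC]
        exact Finset.single_le_sum (fun _ _ => Nat.zero_le _) (Finset.mem_univ v)
      have h := sum_mul_exp_le_of_abs_le_one (fun v => p (C v))
        (fun v => g (C v + 1) - g (C v)) (fun v => by positivity) (sum_p hC) (fun v => by
          have h1 := hg (C v) (by have := hle v; omega)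
          have h2 := hg (C v + 1) (by have := hle v; omega)
          exact abs_le.mpr ⟨by linarith [h1.2, h2.1], by linarith [h1.1, h2.2]⟩) θ
      have h' := mul_le_mul_of_nonneg_left h (Real.exp_pos (θ * ∑ w, g (C w))).le
      rw [← Real.exp_add, Finset.mul_sum] at h'
      simp only [sum_comp_add_single]
      rw [← Real.exp_add]
      refine (Finset.sum_congr rfl fun v _ => ?_).trans_le (h'.trans_eq ?_)
      · rw [mul_add, Real.exp_add]
        ring
      · simp only [hg'_def, Finset.sum_add_distrib]
        ring_nf
    refine le_of_mul_le_mul_right ?_ hc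
    rw [recur, mean_eq, mul_right_comm, card_eq]
    refine (Finset.sum_le_sum fun C hC => exp_step hC).trans ?_
    rw [← Finset.sum_mul]
    refine (mul_le_mul_of_nonneg_right (ih g' hg') (Real.exp_pos _).le).trans_eq ?_
    rw [mul_assoc, ← Real.exp_add]
    push_cast
    ring_nf

/-- Two-sided Chernoff bound for a uniformly random element of a finite set. -/
lemma card_filter_le_of_sum_exp_le {α : Type*} (s : Finset α) (f : α → ℝ) (μ σ lam : ℝ)
    (hσ : 0 < σ) (hlam : 0 < lam)
    (h : ∀ θ : ℝ, ∑ a ∈ s, Real.exp (θ * f a) ≤ s.card * Real.exp (θ * μ + θ ^ 2 * σ / 2)) :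
    ((s.filter fun a => lam ≤ |f a - μ|).card : ℝ)
      ≤ s.card * (2 * Real.exp (-lam ^ 2 / (2 * σ))) := by
  set θ := lam / σ with hθ
  have hθ0 : 0 < θ := by positivity
  have centered (θ : ℝ) : ∑ a ∈ s, Real.exp (θ * (f a - μ)) ≤
      s.card * Real.exp (θ ^ 2 * σ / 2) := by
    have split (a : α) :
        Real.exp (θ * (f a - μ)) = Real.exp (θ * f a) * Real.exp (-(θ * μ)) := by
      rw [← Real.exp_add]
      ring_nf
    simp only [split, ← Finset.sum_mul]
    refine (mul_le_mul_of_nonneg_right (h θ) (Real.exp_pos _).le).trans_eq ?_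
    rw [mul_assoc, ← Real.exp_add]
    ring_nf
  have markov : ((s.filter fun a => lam ≤ |f a - μ|).card : ℝ) * Real.exp (θ * lam) ≤
      ∑ a ∈ s, (Real.exp (θ * (f a - μ)) + Real.exp (-θ * (f a - μ))) := by
    rw [← nsmul_eq_mul]
    refine (Finset.card_nsmul_le_sum _ _ _ fun a ha => ?_).trans
      (Finset.sum_le_sum_of_subset_of_nonneg (Finset.filter_subset _ _)
        fun a _ _ => by positivity)
    rcases le_abs'.mp (Finset.mem_filter.mp ha).2 with h1 | h1
    · have : Real.exp (θ * lam) ≤ Real.exp (-θ * (f a - μ)) :=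
        Real.exp_le_exp.mpr (by nlinarith)
      linarith [Real.exp_pos (θ * (f a - μ))]
    · have : Real.exp (θ * lam) ≤ Real.exp (θ * (f a - μ)) :=
        Real.exp_le_exp.mpr (by nlinarith)
      linarith [Real.exp_pos (-θ * (f a - μ))]
  rw [Finset.sum_add_distrib] at markov
  have hneg := centered (-θ)
  rw [neg_sq] at hneg
  refine le_of_mul_le_mul_right (markov.trans ((add_le_add (centered θ) hneg).trans_eq ?_))
    (Real.exp_pos (θ * lam))
  rw [mul_assoc, mul_assoc, ← Real.exp_add, ← two_mul, hθ]
  have : (lam / σ) ^ 2 * σ / 2 = -lam ^ 2 / (2 * σ) + lam / σ * lam := by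
    field_simp
    ring
  rw [this]
  ring

lemma oddStacks_eq_sum {n : ℕ} (C : Fin n → ℕ) :
    (oddStacks C : ℝ) = ∑ v, if Odd (C v) then (1 : ℝ) else 0 := by
  simp [oddStacks]

lemma natCard_deviation_eq (n t : ℕ) (lam : ℝ) :
    Nat.card {C : Fin n → ℕ // (∑ v, C v) = t ∧ lam ≤ |(oddStacks C : ℝ) - beExpOddStacks n t|}
      = ((configs n t).filter fun C => lam ≤ |(oddStacks C : ℝ) - beExpOddStacks n t|).card := by
  refine Nat.subtype_card _ fun C => ?_
  simp [configs, Finset.Nat.mem_antidiagonalTuple]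


/-- In the Bose Einstein scheme (a configuration of weight `t` on the `n` vertices
of `K_n` chosen uniformly at random among all `C(n+t−1, n−1)` configurations),
the number `X` of odd stacks satisfies, for every `λ > 0`,
`P(|X − E X| ≥ λ) ≤ 2·exp(−λ²/(8t))`. -/
theorem be_oddStacks_concentration (n t : ℕ) (lam : ℝ) (hlam : 0 < lam) :
    ((Nat.card {C : Fin n → ℕ // (∑ v, C v) = t ∧
          lam ≤ |(oddStacks C : ℝ) - beExpOddStacks n t|} : ℕ) : ℝ)
        / ((n + t - 1).choose (n - 1) : ℝ)
      ≤ 2 * Real.exp (-lam ^ 2 / (8 * t)) := by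
  rw [natCard_deviation_eq]
  rcases n with _ | m
  · have hfilter : ((configs 0 t).filter fun C =>
        lam ≤ |(oddStacks C : ℝ) - beExpOddStacks 0 t|) = ∅ := by
      refine Finset.filter_eq_empty_iff.mpr fun C _ => ?_
      simp [oddStacks, beExpOddStacks, hlam]
    rw [hfilter]
    simp only [Finset.card_empty, Nat.cast_zero, zero_div]
    positivity
  have hchoose : (m + 1 + t - 1).choose (m + 1 - 1) = (configs (m + 1) t).card := by
    rw [card_configs]
    congr 1
    omega
  have hpos : (0 : ℝ) < (configs (m + 1) t).card := by
    rw [card_configs]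
    exact_mod_cast Nat.choose_pos (by omega)
  rw [hchoose, div_le_iff₀' hpos]
  rcases t.eq_zero_or_pos with rfl | ht
  · have := Finset.card_filter_le (configs (m + 1) 0)
      fun C => lam ≤ |(oddStacks C : ℝ) - beExpOddStacks (m + 1) 0|
    have : (((configs (m + 1) 0).filter fun C =>
        lam ≤ |(oddStacks C : ℝ) - beExpOddStacks (m + 1) 0|).card : ℝ)
          ≤ (configs (m + 1) 0).card := by exact_mod_cast this
    simp only [Nat.cast_zero, mul_zero, div_zero, Real.exp_zero, mul_one]
    linarith
  have ht' : (0 : ℝ) < t := by exact_mod_cast ht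
  have h := card_filter_le_of_sum_exp_le (configs (m + 1) t) (fun C => (oddStacks C : ℝ))
    (beExpOddStacks (m + 1) t) (4 * t) lam (by positivity) hlam fun θ => by
      have h := sum_configs_exp_le m t θ (fun k => if Odd k then 1 else 0)
        fun k _ => by split_ifs <;> simp
      simp only [← oddStacks_eq_sum] at h
      rw [beExpOddStacks, hchoose]
      convert h using 4
      ring
  rwa [← mul_assoc 2 4 (t : ℝ), show (2 : ℝ) * 4 = 8 by norm_num] at h
end
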